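/- arXiv:2512.24089 — 10 statements merged into one kernel-verified Lean document; each statement's English description precedes it below -/
import Mathlib

section
/- Let c, θ, μ, β₁, β₂ ∈ ℝ and set a = (3β₁ − 3β₂)/4 and b = (3β₁ + β₂)/4. Suppose u, v : ℝ → ℝ are differentiable and satisfy c·u'(y) = (θ + μ)·v(y) + a·u(y)²·v(y) + b·v(y)³ and c·v'(y) = (θ − μ)·u(y) − b·u(y)³ − a·v(y)²·u(y) for all y ∈ ℝ. Then the functions Ψ₋ := (u + i·v)/2 and Ψ₊ := (u − i·v)/2 solve the NLD system with parameters c, θ, μ, β₁, β₂. -/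
open Complex Real

/-- The nonlinear Dirac (NLD) system with real parameters `c, θ, μ, β₁, β₂` for
functions `Ψm, Ψp : ℝ → ℂ`. -/
def NLDSystem (c θ μ β₁ β₂ : ℝ) (Ψm Ψp : ℝ → ℂ) : Prop :=
  ∀ y : ℝ,
    (Complex.I * c * deriv Ψm y + θ * Ψp y - μ * Ψm y =
      ((β₁ : ℂ) * Complex.normSq (Ψm y) + 2 * (β₁ : ℂ) * Complex.normSq (Ψp y)) * Ψm y
        + (β₂ : ℂ) * (starRingEnd ℂ) (Ψm y) * (Ψp y) ^ 2) ∧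
    (-(Complex.I * c * deriv Ψp y) + θ * Ψm y - μ * Ψp y =
      (β₂ : ℂ) * (starRingEnd ℂ) (Ψp y) * (Ψm y) ^ 2
        + ((β₁ : ℂ) * Complex.normSq (Ψp y) + 2 * (β₁ : ℂ) * Complex.normSq (Ψm y)) * Ψp y)

theorem stmt_1 (c θ μ β₁ β₂ : ℝ) (u v : ℝ → ℝ)
    (hu : Differentiable ℝ u) (hv : Differentiable ℝ v)
    (hsys : ∀ y : ℝ,
      c * deriv u y = (θ + μ) * v y + (3 * β₁ - 3 * β₂) / 4 * (u y) ^ 2 * v y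
          + (3 * β₁ + β₂) / 4 * (v y) ^ 3 ∧
      c * deriv v y = (θ - μ) * u y - (3 * β₁ + β₂) / 4 * (u y) ^ 3
          - (3 * β₁ - 3 * β₂) / 4 * (v y) ^ 2 * u y) :
    NLDSystem c θ μ β₁ β₂
      (fun y => ((u y : ℂ) + Complex.I * (v y : ℂ)) / 2)
      (fun y => ((u y : ℂ) - Complex.I * (v y : ℂ)) / 2) := by
  intro y
  obtain ⟨h1, h2⟩ := hsys y
  have hU : HasDerivAt (fun y => (u y : ℂ)) ((deriv u y : ℝ) : ℂ) y :=
    (hu y).hasDerivAt.ofReal_comp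
  have hV : HasDerivAt (fun y => (v y : ℂ)) ((deriv v y : ℝ) : ℂ) y :=
    (hv y).hasDerivAt.ofReal_comp
  have hm := ((hU.add (hV.const_mul Complex.I)).div_const 2).deriv
  have hp := ((hU.sub (hV.const_mul Complex.I)).div_const 2).deriv
  have em : deriv (fun y => ((u y : ℂ) + Complex.I * (v y : ℂ)) / 2) y
      = ((deriv u y : ℝ) + Complex.I * (deriv v y : ℝ)) / 2 := hm
  have ep : deriv (fun y => ((u y : ℂ) - Complex.I * (v y : ℂ)) / 2) y
      = ((deriv u y : ℝ) - Complex.I * (deriv v y : ℝ)) / 2 := hp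
  have H1 := congrArg (fun x : ℝ => (x : ℂ)) h1
  have H2 := congrArg (fun x : ℝ => (x : ℂ)) h2
  push_cast at H1 H2
  have hI : Complex.I ^ 2 = -1 := Complex.I_sq
  simp only [em, ep, Complex.normSq_eq_conj_mul_self]
  simp only [map_div₀, map_add, map_sub, map_mul,
    Complex.conj_ofReal, Complex.conj_I, map_ofNat]
  generalize ((deriv u y : ℝ) : ℂ) = du at *
  generalize ((deriv v y : ℝ) : ℂ) = dv at *
  generalize (u y : ℂ) = U at *
  generalize (v y : ℂ) = V at *
  generalize Complex.I = J at *
  have hJ3 : J ^ 3 = -J := by linear_combination J * hI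
  have hJ4 : J ^ 4 = 1 := by linear_combination (J ^ 2 - 1) * hI
  constructor
  · ring_nf
    simp only [hI, hJ3, hJ4]
    linear_combination J / 2 * H1 - 1 / 2 * H2
  · ring_nf
    simp only [hI, hJ3, hJ4]
    linear_combination -J / 2 * H1 - 1 / 2 * H2
end

section
/- Let a ≥ 0, b > 0 and −1 < μ < 1. Then H(√((1−μ)/b), 0) = H(−√((1−μ)/b), 0) = −(1−μ)²/(4b) < 0. Consequently, the origin (0,0) is the only point (u,v) ∈ ℝ² with H(u,v) = 0 that satisfies the equilibrium equations v + μ·v + a·u²·v + b·v³ = 0 and u − μ·u − b·u³ − a·v²·u = 0. -/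
/-- The Hamiltonian of the planar system (S). -/
noncomputable def Ham (a b μ : ℝ) (u v : ℝ) : ℝ :=
  b / 4 * (u ^ 4 + v ^ 4) + a / 2 * u ^ 2 * v ^ 2 + μ / 2 * (u ^ 2 + v ^ 2)
    + 1 / 2 * (v ^ 2 - u ^ 2)

theorem stmt_4 (a b μ : ℝ) (ha : a ≥ 0) (hb : b > 0) (hμ : -1 < μ) (hμ' : μ < 1) :
    (Ham a b μ (Real.sqrt ((1 - μ) / b)) 0 = -(1 - μ) ^ 2 / (4 * b) ∧
     Ham a b μ (-Real.sqrt ((1 - μ) / b)) 0 = -(1 - μ) ^ 2 / (4 * b) ∧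
     -(1 - μ) ^ 2 / (4 * b) < 0) ∧
    (∀ u v : ℝ, Ham a b μ u v = 0 →
      v + μ * v + a * u ^ 2 * v + b * v ^ 3 = 0 →
      u - μ * u - b * u ^ 3 - a * v ^ 2 * u = 0 →
      (u, v) = ((0 : ℝ), (0 : ℝ))) := by
  have h1 : 0 < 1 - μ := by linarith
  have hs : Real.sqrt ((1 - μ) / b) ^ 2 = (1 - μ) / b := Real.sq_sqrt (by positivity)
  have key : ∀ x : ℝ, x ^ 2 = (1 - μ) / b → Ham a b μ x 0 = -(1 - μ) ^ 2 / (4 * b) := by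
    intro x hx
    have e : Ham a b μ x 0 = b / 4 * (x ^ 2) ^ 2 - (1 - μ) / 2 * x ^ 2 := by
      unfold Ham
      ring
    rw [e, hx]
    field_simp
    ring
  refine ⟨⟨key _ hs, key _ (by rw [neg_sq, hs]), ?_⟩, ?_⟩
  · rw [neg_div, neg_lt_zero]
    positivity
  · intro u v hH hv hu
    have hv0 : v = 0 := by
      have hpos : 0 < 1 + μ + a * u ^ 2 + b * v ^ 2 := by
        have : 0 < 1 + μ := by linarith
        have : 0 ≤ a * u ^ 2 := by positivity
        have : 0 ≤ b * v ^ 2 := by positivity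
        linarith
      have hm : v * (1 + μ + a * u ^ 2 + b * v ^ 2) = 0 := by linarith
      exact (mul_eq_zero.mp hm).resolve_right hpos.ne'
    subst hv0
    have hu0 : (1 - μ) * u ^ 2 = 0 := by
      unfold Ham at hH
      linear_combination (-4) * hH - u * hu
    have : u = 0 := by
      have := (mul_eq_zero.mp hu0).resolve_left h1.ne'
      exact pow_eq_zero_iff (two_ne_zero) |>.mp this
    rw [this]
end

section
/- Let a ≥ 0, b > 0 and −1 < μ < 1. Then the zero level set H₀ := {(u, v) ∈ ℝ × ℝ : H(u, v) = 0} is a compact subset of ℝ². -/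
theorem stmt_5 (a b μ : ℝ) (ha : a ≥ 0) (hb : b > 0) (hμ : -1 < μ) (hμ' : μ < 1) :
    IsCompact {p : ℝ × ℝ | Ham a b μ p.1 p.2 = 0} := by
  have key : ∀ p : ℝ × ℝ, Ham a b μ p.1 p.2 = 0 → p.1 ^ 2 ≤ 4 / b ∧ p.2 ^ 2 ≤ 4 / b := by
    rintro ⟨u, v⟩ h
    simp only [Ham] at h ⊢
    have h1 : 0 ≤ a / 2 * u ^ 2 * v ^ 2 := by positivity
    have h2 : 0 ≤ (1 + μ) * v ^ 2 := mul_nonneg (by linarith) (sq_nonneg v)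
    have h3 : 0 ≤ (1 + μ) * u ^ 2 := mul_nonneg (by linarith) (sq_nonneg u)
    have h4 : b * u ^ 4 + b * v ^ 4 ≤ 4 * u ^ 2 := by nlinarith
    have h5 : 0 ≤ b * v ^ 4 := by positivity
    have h6 : 0 ≤ b * u ^ 4 := by positivity
    have hu : u ^ 2 * b ≤ 4 := by
      by_contra hc
      push Not at hc
      have hpos : 0 < u ^ 2 := by
        by_contra h0
        nlinarith
      nlinarith [mul_pos hpos (sub_pos.2 hc)]
    have hv : v ^ 2 * b ≤ 4 := by
      apply le_of_abs_le
      apply abs_le_of_sq_le_sq _ (by norm_num)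
      nlinarith
    exact ⟨(le_div_iff₀ hb).2 hu, (le_div_iff₀ hb).2 hv⟩
  have hR : 0 < 4 / b := by positivity
  refine IsCompact.of_isClosed_subset
    ((isCompact_Icc (a := -(1 + 4 / b)) (b := 1 + 4 / b)).prod
      (isCompact_Icc (a := -(1 + 4 / b)) (b := 1 + 4 / b))) ?_ ?_
  · apply isClosed_eq _ continuous_const
    unfold Ham
    fun_prop
  · intro p hp
    obtain ⟨h1, h2⟩ := key p hp
    refine ⟨⟨?_, ?_⟩, ⟨?_, ?_⟩⟩ <;> nlinarith [sq_nonneg (p.1 - 1), sq_nonneg (p.1 + 1),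
      sq_nonneg (p.2 - 1), sq_nonneg (p.2 + 1)]
end

section
/- Let a ≥ 0, b > 0 and μ ∈ ℝ, and let (u, v) ∈ ℝ² satisfy H(u, v) = 0. Then (u − μ·u − b·u³ − a·v²·u)·u − (v + μ·v + a·u²·v + b·v³)·v = −(b·(u⁴ + v⁴) + 2a·u²·v²)/2. In particular, if (u, v) ≠ (0, 0), this quantity is strictly negative. -/
theorem stmt_7 (a b μ : ℝ) (ha : a ≥ 0) (hb : b > 0) (u v : ℝ)
    (hH : Ham a b μ u v = 0) :
    (u - μ * u - b * u ^ 3 - a * v ^ 2 * u) * u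
        - (v + μ * v + a * u ^ 2 * v + b * v ^ 3) * v =
      -(b * (u ^ 4 + v ^ 4) + 2 * a * u ^ 2 * v ^ 2) / 2 ∧
    ((u, v) ≠ ((0 : ℝ), (0 : ℝ)) →
      (u - μ * u - b * u ^ 3 - a * v ^ 2 * u) * u
        - (v + μ * v + a * u ^ 2 * v + b * v ^ 3) * v < 0) := by
  have key : (u - μ * u - b * u ^ 3 - a * v ^ 2 * u) * u
        - (v + μ * v + a * u ^ 2 * v + b * v ^ 3) * v =
      -(b * (u ^ 4 + v ^ 4) + 2 * a * u ^ 2 * v ^ 2) / 2 := by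
    unfold Ham at hH
    linear_combination (-2) * hH
  refine ⟨key, fun hne => ?_⟩
  rw [key]
  have h1 : 0 < u ^ 4 + v ^ 4 := by
    by_cases hu : u = 0
    · have hv : v ≠ 0 := fun hv => hne (by rw [hu, hv])
      positivity
    · positivity
  have h2 : 0 < b * (u ^ 4 + v ^ 4) := mul_pos hb h1
  have h3 : 0 ≤ 2 * a * u ^ 2 * v ^ 2 := by positivity
  linarith
end

section
/- Let a, b, μ ∈ ℝ and let u, v : ℝ → ℝ be differentiable functions solving the planar system (S) on all of ℝ with v(0) = 0. Then u(−y) = u(y) and v(−y) = −v(y) for all y ∈ ℝ, i.e., u is even and v is odd. -/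
/-- The planar system (S) with real parameters `a, b, μ` for functions `u, v : ℝ → ℝ`. -/
def PlanarSystem (a b μ : ℝ) (u v : ℝ → ℝ) : Prop :=
  ∀ y : ℝ,
    deriv u y = v y + μ * v y + a * (u y) ^ 2 * v y + b * (v y) ^ 3 ∧
    deriv v y = u y - μ * u y - b * (u y) ^ 3 - a * (v y) ^ 2 * u y

theorem stmt_8 (a b μ : ℝ) (u v : ℝ → ℝ)
    (hu : Differentiable ℝ u) (hv : Differentiable ℝ v)
    (hsys : PlanarSystem a b μ u v) (hv0 : v 0 = 0) :
    (∀ y : ℝ, u (-y) = u y) ∧ (∀ y : ℝ, v (-y) = -v y) := by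
  let F : ℝ × ℝ → ℝ × ℝ := fun p =>
    (p.2 + μ * p.2 + a * p.1 ^ 2 * p.2 + b * p.2 ^ 3,
      p.1 - μ * p.1 - b * p.1 ^ 3 - a * p.2 ^ 2 * p.1)
  have hF : ContDiff ℝ 1 F := by
    simp only [F]
    fun_prop
  let f : ℝ → ℝ × ℝ := fun y => (u y, v y)
  let g : ℝ → ℝ × ℝ := fun y => (u (-y), -v (-y))
  have hud : ∀ y, HasDerivAt u (F (f y)).1 y := fun y => by
    have h := (hu y).hasDerivAt
    rwa [(hsys y).1] at h
  have hvd : ∀ y, HasDerivAt v (F (f y)).2 y := fun y => by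
    have h := (hv y).hasDerivAt
    rwa [(hsys y).2] at h
  have hf : ∀ y, HasDerivAt f (F (f y)) y := fun y => (hud y).prodMk (hvd y)
  have hg : ∀ y, HasDerivAt g (F (g y)) y := fun y => by
    have h1 := (hud (-y)).comp y (hasDerivAt_neg y)
    have h2 := ((hvd (-y)).comp y (hasDerivAt_neg y)).neg
    have h3 := h1.prodMk h2
    have he : F (g y) = ((F (f (-y))).1 * -1, -((F (f (-y))).2 * -1)) := by
      simp only [F, f, g]
      ext <;> simp <;> ring
    rw [he]
    exact h3
  have hfc : Continuous f := continuous_iff_continuousAt.2 fun y => (hf y).continuousAt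
  have hgc : Continuous g := continuous_iff_continuousAt.2 fun y => (hg y).continuousAt
  have key : ∀ y, f y = g y := by
    intro y
    let I : Set ℝ := Set.Icc (-(|y| + 1)) (|y| + 1)
    have hI : IsCompact I := isCompact_Icc
    have hb : Bornology.IsBounded (f '' I ∪ g '' I) :=
      (hI.image hfc).isBounded.union (hI.image hgc).isBounded
    obtain ⟨R, hR⟩ := hb.subset_closedBall (0 : ℝ × ℝ)
    obtain ⟨K, hK⟩ := (hF.contDiffOn (s := Metric.closedBall (0 : ℝ × ℝ) R)).exists_lipschitzOnWith
      one_ne_zero (convex_closedBall _ _) (isCompact_closedBall _ _)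
    have hy := abs_le.1 (le_refl |y|)
    have hy0 := abs_nonneg y
    refine ODE_solution_unique_of_mem_Ioo (v := fun _ => F) (K := K)
      (s := fun _ => Metric.closedBall (0 : ℝ × ℝ) R) (t₀ := 0)
      (a := -(|y| + 1)) (b := |y| + 1) (fun _ _ => hK) ⟨by linarith, by linarith⟩
      (fun t ht => ⟨hf t, hR (Or.inl ⟨t, Set.Ioo_subset_Icc_self ht, rfl⟩)⟩)
      (fun t ht => ⟨hg t, hR (Or.inr ⟨t, Set.Ioo_subset_Icc_self ht, rfl⟩)⟩)
      (by simp [f, g, hv0]) ⟨by linarith, by linarith⟩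
  refine ⟨fun y => (congrArg Prod.fst (key y)).symm, fun y => ?_⟩
  have h : v y = -v (-y) := congrArg Prod.snd (key y)
  linarith
end

section
/- Let a ≥ 0, b > 0 and −1 < μ < 1. Then there exist infinitely differentiable functions u, v : ℝ → ℝ solving the planar system (S) on all of ℝ with u(0) = √(2(1−μ)/b) and v(0) = 0, such that u is even, v is odd, u(y) > 0 for every y ∈ ℝ, and both u(y) → 0 and v(y) → 0 as y → +∞ and as y → −∞. -/
open Filter

/-- cosh tends to infinity. -/
theorem aux_cosh_tendsto : Tendsto Real.cosh atTop atTop := by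
  refine tendsto_atTop_mono (f := fun x : ℝ => Real.exp x / 2) ?_ ?_
  · intro x
    rw [Real.cosh_eq]
    have := Real.exp_pos (-x)
    linarith
  · exact Real.tendsto_exp_atTop.atTop_div_const (by norm_num)

theorem stmt_9 (a b μ : ℝ) (ha : a ≥ 0) (hb : b > 0) (hμ : -1 < μ) (hμ' : μ < 1) :
    ∃ u v : ℝ → ℝ,
      ContDiff ℝ (⊤ : ℕ∞) u ∧ ContDiff ℝ (⊤ : ℕ∞) v ∧
      PlanarSystem a b μ u v ∧
      u 0 = Real.sqrt (2 * (1 - μ) / b) ∧ v 0 = 0 ∧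
      (∀ y : ℝ, u (-y) = u y) ∧ (∀ y : ℝ, v (-y) = -v y) ∧
      (∀ y : ℝ, u y > 0) ∧
      Tendsto u atTop (nhds 0) ∧ Tendsto v atTop (nhds 0) ∧
      Tendsto u atBot (nhds 0) ∧ Tendsto v atBot (nhds 0) := by
  have h1 : 0 < 1 + μ := by linarith
  have h2 : 0 < 1 - μ := by linarith
  obtain ⟨p, hp, hp2⟩ : ∃ p : ℝ, 0 < p ∧ p ^ 2 = 1 + μ :=
    ⟨Real.sqrt (1 + μ), Real.sqrt_pos.2 h1, Real.sq_sqrt h1.le⟩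
  obtain ⟨q, hq, hq2⟩ : ∃ q : ℝ, 0 < q ∧ q ^ 2 = 1 - μ :=
    ⟨Real.sqrt (1 - μ), Real.sqrt_pos.2 h2, Real.sq_sqrt h2.le⟩
  -- the ratio t = v / u
  obtain ⟨t, ht⟩ : ∃ t : ℝ → ℝ, t = fun y =>
    -(q / p) * (Real.sinh (p * q * y) / Real.cosh (p * q * y)) := ⟨_, rfl⟩
  have hc : ∀ y : ℝ, 0 < Real.cosh (p * q * y) := fun y => Real.cosh_pos _
  have htN : ∀ y, (1 - μ) - (1 + μ) * t y ^ 2 = (1 - μ) / Real.cosh (p * q * y) ^ 2 := by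
    intro y
    have := Real.cosh_sq (p * q * y)
    have hcy := (hc y).ne'
    rw [ht, ← hp2, ← hq2]
    field_simp
    rw [mul_comm q p, this]; ring
  have htd : ∀ y, HasDerivAt t (-((1 - μ) - (1 + μ) * t y ^ 2)) y := by
    intro y
    rw [htN y, ht]
    have hl : HasDerivAt (fun y : ℝ => p * q * y) (p * q) y := by
      simpa using (hasDerivAt_id y).const_mul (p * q)
    have h := ((hl.sinh.div hl.cosh (hc y).ne').const_mul (-(q / p)))
    refine h.congr_deriv ?_
    have := Real.cosh_sq (p * q * y)
    have hcy := (hc y).ne'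
    rw [← hq2]
    field_simp
    rw [mul_comm q p, this]; ring
  have htC : ContDiff ℝ (⊤ : ℕ∞) t := by
    rw [ht]
    have hl : ContDiff ℝ (⊤ : ℕ∞) (fun y : ℝ => p * q * y) := contDiff_const.mul contDiff_id
    exact contDiff_const.mul (hl.sinh.div hl.cosh (fun y => (hc y).ne'))
  have ht0 : t 0 = 0 := by rw [ht]; simp
  have htodd : ∀ y, t (-y) = - t y := by
    intro y
    rw [ht]
    simp only [mul_neg, Real.sinh_neg, Real.cosh_neg]
    ring
  have hNpos : ∀ y, 0 < (1 - μ) - (1 + μ) * t y ^ 2 := by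
    intro y
    rw [htN y]
    exact div_pos h2 (pow_pos (hc y) 2)
  have hNlim : Tendsto (fun y => (1 - μ) - (1 + μ) * t y ^ 2) atTop (nhds 0) := by
    simp_rw [htN]
    have hl : Tendsto (fun y : ℝ => p * q * y) atTop atTop :=
      tendsto_id.const_mul_atTop (mul_pos hp hq)
    exact Tendsto.const_div_atTop
      ((tendsto_pow_atTop (by norm_num)).comp (aux_cosh_tendsto.comp hl)) _
  clear ht htN hc
  obtain ⟨D, hD⟩ : ∃ D : ℝ → ℝ, D = fun y => b * (1 + t y ^ 4) + 2 * a * t y ^ 2 := ⟨_, rfl⟩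
  have hDb : ∀ y, b ≤ D y := by
    intro y
    rw [hD]
    have e1 : 0 ≤ b * t y ^ 4 := by positivity
    have e2 : 0 ≤ 2 * a * t y ^ 2 := by positivity
    simp only
    linarith
  have hDpos : ∀ y, 0 < D y := fun y => lt_of_lt_of_le hb (hDb y)
  obtain ⟨W, hW⟩ : ∃ W : ℝ → ℝ, W = fun y => 2 * ((1 - μ) - (1 + μ) * t y ^ 2) / D y := ⟨_, rfl⟩
  have hWpos : ∀ y, 0 < W y := by
    intro y
    rw [hW]
    exact div_pos (mul_pos two_pos (hNpos y)) (hDpos y)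
  have hWD : ∀ y, W y * (b * (1 + t y ^ 4) + 2 * a * t y ^ 2)
      = 2 * ((1 - μ) - (1 + μ) * t y ^ 2) := by
    intro y
    have := (hDpos y).ne'
    have h3 : D y = b * (1 + t y ^ 4) + 2 * a * t y ^ 2 := by rw [hD]
    rw [← h3, hW]
    field_simp
  have hWd : ∀ y, HasDerivAt W
      (2 * W y * ((1 + μ) * t y + W y * (a * t y + b * t y ^ 3))) y := by
    intro y
    have hDy := (hDpos y).ne'
    have hDd : HasDerivAt D (-(4 * (b * t y ^ 3 + a * t y)) *
        ((1 - μ) - (1 + μ) * t y ^ 2)) y := by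
      rw [hD]
      have h := ((((htd y).pow 4).const_add 1).const_mul b).add
        (((htd y).pow 2).const_mul (2 * a))
      refine h.congr_deriv ?_
      push_cast
      ring
    have h := (((((htd y).pow 2).const_mul (1 + μ)).const_sub (1 - μ)).const_mul 2).div hDd hDy
    have h4 := h.congr_deriv (g' := 2 * W y * ((1 + μ) * t y + W y * (a * t y + b * t y ^ 3))) (by
      rw [hW]
      simp only [Pi.pow_apply]
      field_simp
      push_cast
      ring)
    rw [hW] at h4 ⊢
    exact h4
  have hWC : ContDiff ℝ (⊤ : ℕ∞) W := by
    rw [hW]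
    refine ContDiff.div ?_ ?_ (fun y => (hDpos y).ne')
    · fun_prop
    · rw [hD]; fun_prop
  have hWlim : Tendsto W atTop (nhds 0) := by
    have h := (hNlim.const_mul 2).div_const b
    simp only [mul_zero, zero_div] at h
    refine squeeze_zero (fun y => (hWpos y).le) ?_ h
    intro y
    rw [hW]
    exact div_le_div_of_nonneg_left (mul_pos two_pos (hNpos y)).le hb (hDb y)
  have hWev : ∀ y, W (-y) = W y := by
    intro y
    rw [hW, hD]
    simp only [htodd]
    ring
  have hW0 : W 0 = 2 * (1 - μ) / b := by
    rw [hW, hD]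
    simp [ht0]
  have huC : ContDiff ℝ (⊤ : ℕ∞) (fun y => Real.sqrt (W y)) :=
    hWC.sqrt (fun y => (hWpos y).ne')
  have hud : ∀ y, HasDerivAt (fun y => Real.sqrt (W y))
      (Real.sqrt (W y) * ((1 + μ) * t y + W y * (a * t y + b * t y ^ 3))) y := by
    intro y
    have hs : 0 < Real.sqrt (W y) := Real.sqrt_pos.2 (hWpos y)
    have hs2 : Real.sqrt (W y) ^ 2 = W y := Real.sq_sqrt (hWpos y).le
    refine ((hWd y).sqrt (hWpos y).ne').congr_deriv ?_
    rw [div_eq_iff (by positivity)]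
    linear_combination (-2) * ((1 + μ) * t y + W y * (a * t y + b * t y ^ 3)) * hs2
  have hulim : Tendsto (fun y => Real.sqrt (W y)) atTop (nhds 0) := by
    simpa using hWlim.sqrt
  have hvlim : Tendsto (fun y => t y * Real.sqrt (W y)) atTop (nhds 0) := by
    have h : Tendsto (fun y => (q / p) * Real.sqrt (W y)) atTop (nhds 0) := by
      simpa using hulim.const_mul (q / p)
    refine squeeze_zero_norm ?_ h
    intro y
    rw [norm_mul, Real.norm_eq_abs, Real.norm_eq_abs, abs_of_nonneg (Real.sqrt_nonneg _)]
    refine mul_le_mul_of_nonneg_right ?_ (Real.sqrt_nonneg _)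
    refine abs_le_of_sq_le_sq ?_ (div_pos hq hp).le
    rw [div_pow, hp2, hq2, le_div_iff₀ h1]
    have := hNpos y
    linarith
  have huev : ∀ y, Real.sqrt (W (-y)) = Real.sqrt (W y) := fun y => by rw [hWev]
  have hvodd : ∀ y, t (-y) * Real.sqrt (W (-y)) = -(t y * Real.sqrt (W y)) := fun y => by
    rw [hWev, htodd]; ring
  refine ⟨fun y => Real.sqrt (W y), fun y => t y * Real.sqrt (W y), huC, htC.mul huC, ?_,
    by simp only [hW0], by simp [ht0], huev, hvodd, fun y => Real.sqrt_pos.2 (hWpos y),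
    hulim, hvlim, ?_, ?_⟩
  · intro y
    have hs2 : Real.sqrt (W y) ^ 2 = W y := Real.sq_sqrt (hWpos y).le
    have hs3 : Real.sqrt (W y) ^ 3 = W y * Real.sqrt (W y) := by rw [pow_succ, hs2]
    have hv := (htd y).mul (hud y)
    refine ⟨?_, ?_⟩
    · rw [(hud y).deriv]
      simp only [mul_pow, hs2, hs3]
      ring
    · refine hv.deriv.trans ?_
      simp only [mul_pow, hs2, hs3]
      linear_combination (Real.sqrt (W y)) * hWD y
  · have h := hulim.comp tendsto_neg_atBot_atTop
    refine h.congr ?_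
    intro y
    exact huev y
  · have h := (hvlim.comp tendsto_neg_atBot_atTop).neg
    rw [neg_zero] at h
    refine h.congr ?_
    intro y
    simp only [Function.comp]
    rw [hvodd, neg_neg]
end

section
/- Let c, θ, μ, β₁, β₂ ∈ ℝ, let Ψ₋ : ℝ → ℂ be twice differentiable, set Ψ₊(y) := conj(Ψ₋(y)), and suppose the pair (Ψ₋, Ψ₊) solves the NLD system with parameters c, θ, μ, β₁, β₂. Then the derivatives η₁ := Ψ₋' and η₂ := Ψ₊' solve the linearized Dirac system (L) associated with Ψ₋ and the same parameters. -/
open Complex Filter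

/-- The linearized Dirac system (L) associated with a profile `Ψ : ℝ → ℂ` and real
parameters `c, θ, μ, β₁, β₂`, for functions `η₁, η₂ : ℝ → ℂ`. -/
def LinDiracSystem (c θ μ β₁ β₂ : ℝ) (Ψ : ℝ → ℂ) (η₁ η₂ : ℝ → ℂ) : Prop :=
  ∀ y : ℝ,
    (Complex.I * c * deriv η₁ y + θ * η₂ y - μ * η₁ y =
      6 * (β₁ : ℂ) * Complex.normSq (Ψ y) * η₁ y
        + 3 * ((β₁ : ℂ) * (Ψ y) ^ 2 + (β₂ : ℂ) * ((starRingEnd ℂ) (Ψ y)) ^ 2) * η₂ y) ∧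
    (-(Complex.I * c * deriv η₂ y) + θ * η₁ y - μ * η₂ y =
      3 * ((β₁ : ℂ) * ((starRingEnd ℂ) (Ψ y)) ^ 2 + (β₂ : ℂ) * (Ψ y) ^ 2) * η₁ y
        + 6 * (β₁ : ℂ) * Complex.normSq (Ψ y) * η₂ y)

theorem stmt_11 (c θ μ β₁ β₂ : ℝ) (Ψm : ℝ → ℂ)
    (hΨ : Differentiable ℝ Ψm) (hΨ' : Differentiable ℝ (deriv Ψm))
    (hNLD : NLDSystem c θ μ β₁ β₂ Ψm (fun y => (starRingEnd ℂ) (Ψm y))) :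
    LinDiracSystem c θ μ β₁ β₂ Ψm
      (deriv Ψm) (deriv fun y => (starRingEnd ℂ) (Ψm y)) := by
  have hd : ∀ y, HasDerivAt Ψm (deriv Ψm y) y := fun y => (hΨ y).hasDerivAt
  have hcd : ∀ y, HasDerivAt (fun y => (starRingEnd ℂ) (Ψm y))
      ((starRingEnd ℂ) (deriv Ψm y)) y := fun y => (hd y).star
  have hd2 : ∀ y, HasDerivAt (deriv Ψm) (deriv (deriv Ψm) y) y :=
    fun y => (hΨ' y).hasDerivAt
  have hE : (deriv fun y => (starRingEnd ℂ) (Ψm y))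
      = fun y => (starRingEnd ℂ) (deriv Ψm y) := funext fun y => (hcd y).deriv
  have hcd2 : ∀ y, HasDerivAt (fun y => (starRingEnd ℂ) (deriv Ψm y))
      ((starRingEnd ℂ) (deriv (deriv Ψm) y)) y := fun y => (hd2 y).star
  unfold NLDSystem at hNLD
  rw [hE] at hNLD ⊢
  have h1 : (fun y => Complex.I * c * deriv Ψm y + θ * (starRingEnd ℂ) (Ψm y) - μ * Ψm y)
      = fun y => 3 * (β₁ : ℂ) * (Ψm y ^ 2 * (starRingEnd ℂ) (Ψm y))
        + (β₂ : ℂ) * (starRingEnd ℂ) (Ψm y) ^ 3 := by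
    funext y
    have h := (hNLD y).1
    simp only [Complex.normSq_conj, Complex.normSq_eq_conj_mul_self] at h
    rw [h]
    ring
  have h2 : (fun y => -(Complex.I * c * (starRingEnd ℂ) (deriv Ψm y)) + θ * Ψm y
        - μ * (starRingEnd ℂ) (Ψm y))
      = fun y => 3 * (β₁ : ℂ) * ((starRingEnd ℂ) (Ψm y) ^ 2 * Ψm y)
        + (β₂ : ℂ) * Ψm y ^ 3 := by
    funext y
    have h := (hNLD y).2
    simp only [Complex.normSq_conj, Complex.normSq_eq_conj_mul_self, Complex.conj_conj] at h
    rw [h]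
    ring
  intro y
  have l1 := (((hd2 y).const_mul (Complex.I * c)).add ((hcd y).const_mul (θ : ℂ))).sub
    ((hd y).const_mul (μ : ℂ))
  have r1 := ((((hd y).pow 2).mul (hcd y)).const_mul (3 * (β₁ : ℂ))).add
    (((hcd y).pow 3).const_mul (β₂ : ℂ))
  have l2 := ((((hcd2 y).const_mul (Complex.I * c)).neg).add ((hd y).const_mul (θ : ℂ))).sub
    ((hcd y).const_mul (μ : ℂ))
  have r2 := ((((hcd y).pow 2).mul (hd y)).const_mul (3 * (β₁ : ℂ))).add
    (((hd y).pow 3).const_mul (β₂ : ℂ))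
  have e1 := HasDerivAt.unique (h1 ▸ (show HasDerivAt (fun y => Complex.I * c * deriv Ψm y
    + θ * (starRingEnd ℂ) (Ψm y) - μ * Ψm y) _ y from l1)) r1
  have e2 := HasDerivAt.unique (h2 ▸ (show HasDerivAt (fun y =>
    -(Complex.I * c * (starRingEnd ℂ) (deriv Ψm y)) + θ * Ψm y
        - μ * (starRingEnd ℂ) (Ψm y)) _ y from l2)) r2
  simp only [Complex.normSq_eq_conj_mul_self]
  constructor
  · rw [e1]
    simp
    ring
  · rw [(hcd2 y).deriv, e2]
    simp
    ring
end

section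
/- Let c, θ, μ, β₁, β₂ ∈ ℝ with c ≠ 0. Let Ψ₋ : ℝ → ℂ be infinitely differentiable, not identically zero, with Ψ₋(y) → 0 and Ψ₋'(y) → 0 as y → +∞ and as y → −∞; set Ψ₊(y) := conj(Ψ₋(y)) and suppose (Ψ₋, Ψ₊) solves the NLD system. If (φ₁, φ₂) is a pair of differentiable functions ℝ → ℂ solving the linearized Dirac system (L) associated with Ψ₋, satisfying conj(φ₁(x)) = φ₂(x) for all x ∈ ℝ, and with φ₁(x), φ₂(x) → 0 as x → +∞ and as x → −∞, then there exists λ ∈ ℝ such that φ₁ = λ·Ψ₋' and φ₂ = λ·Ψ₊'. -/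
open Complex Filter

/-- The right-hand side of the linearized equation for real-type solutions. -/
noncomputable def linV (c θ μ β₁ β₂ : ℝ) (p η : ℂ) : ℂ :=
  -(Complex.I / c) * ((μ + 6 * β₁ * Complex.normSq p : ℝ) * η +
    (3 * ((β₁ : ℂ) * p ^ 2 + (β₂ : ℂ) * ((starRingEnd ℂ) p) ^ 2) - θ) * (starRingEnd ℂ) η)

lemma hasDerivAt_conj {f : ℝ → ℂ} {f' : ℂ} {x : ℝ} (h : HasDerivAt f f' x) :
    HasDerivAt (fun y => (starRingEnd ℂ) (f y)) ((starRingEnd ℂ) f') x :=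
  (Complex.conjCLE.toContinuousLinearMap.hasFDerivAt.comp_hasDerivAt x h)

lemma linV_sub (c θ μ β₁ β₂ : ℝ) (p a b : ℂ) :
    linV c θ μ β₁ β₂ p a - linV c θ μ β₁ β₂ p b = linV c θ μ β₁ β₂ p (a - b) := by
  simp only [linV, map_sub]; ring

lemma linV_smul (c θ μ β₁ β₂ : ℝ) (p a : ℂ) (l : ℝ) :
    linV c θ μ β₁ β₂ p (l * a) = l * linV c θ μ β₁ β₂ p a := by
  simp only [linV, map_mul, Complex.conj_ofReal]; ring

lemma linV_bound (c θ μ β₁ β₂ : ℝ) (p a : ℂ) (M : ℝ) (hp : ‖p‖ ≤ M) :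
    ‖linV c θ μ β₁ β₂ p a‖ ≤ |c|⁻¹ * ((|μ| + 6 * |β₁| * M ^ 2) +
      (3 * (|β₁| * M ^ 2 + |β₂| * M ^ 2) + |θ|)) * ‖a‖ := by
  have hsq : ‖p‖ ^ 2 ≤ M ^ 2 := by gcongr
  unfold linV
  rw [norm_mul, norm_neg, norm_div, Complex.norm_I, Complex.norm_real, Real.norm_eq_abs, one_div,
    mul_assoc (|c|⁻¹)]
  refine mul_le_mul_of_nonneg_left ?_ (inv_nonneg.mpr (abs_nonneg c))
  refine (norm_add_le _ _).trans ?_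
  rw [add_mul, norm_mul, norm_mul, Complex.norm_conj a]
  refine add_le_add (mul_le_mul_of_nonneg_right ?_ (norm_nonneg _))
    (mul_le_mul_of_nonneg_right ?_ (norm_nonneg _))
  · rw [Complex.norm_real, Real.norm_eq_abs, Complex.normSq_eq_norm_sq]
    refine (abs_add_le _ _).trans ?_
    rw [abs_mul, abs_mul, abs_of_nonneg (sq_nonneg ‖p‖), abs_of_nonneg (by norm_num : (0:ℝ) ≤ 6)]
    gcongr
  · refine (norm_sub_le _ _).trans ?_
    rw [Complex.norm_real, Real.norm_eq_abs θ, norm_mul]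
    have h3 : ‖(3:ℂ)‖ = 3 := by simp
    rw [h3]
    gcongr
    refine (norm_add_le _ _).trans ?_
    rw [norm_mul, norm_mul, norm_pow, norm_pow, Complex.norm_conj, Complex.norm_real,
      Complex.norm_real, Real.norm_eq_abs, Real.norm_eq_abs]
    gcongr

/-- The Wronskian is stationary. -/
lemma wronskian_zero (c θ μ β₁ β₂ : ℝ) (p u v : ℂ) :
    ((starRingEnd ℂ) (linV c θ μ β₁ β₂ p u) * v +
      (starRingEnd ℂ) u * linV c θ μ β₁ β₂ p v).im = 0 := by
  set B : ℂ := 3 * ((β₁ : ℂ) * p ^ 2 + (β₂ : ℂ) * ((starRingEnd ℂ) p) ^ 2) - θ with hB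
  have e : ∀ η, linV c θ μ β₁ β₂ p η = ((c⁻¹ : ℝ) : ℂ) * (-Complex.I *
      ((μ + 6 * β₁ * Complex.normSq p : ℝ) * η + B * (starRingEnd ℂ) η)) := by
    intro η; rw [linV, ← hB]; push_cast; ring
  rw [e, e]
  generalize (μ + 6 * β₁ * Complex.normSq p : ℝ) = A
  generalize c⁻¹ = d
  simp
  ring

theorem stmt_14 (c θ μ β₁ β₂ : ℝ) (hc : c ≠ 0) (Ψm : ℝ → ℂ)
    (hΨsmooth : ContDiff ℝ (⊤ : ℕ∞) Ψm)
    (hΨne : ¬ ∀ y : ℝ, Ψm y = 0)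
    (hΨtop : Tendsto Ψm atTop (nhds 0)) (hΨbot : Tendsto Ψm atBot (nhds 0))
    (hΨ'top : Tendsto (deriv Ψm) atTop (nhds 0))
    (hΨ'bot : Tendsto (deriv Ψm) atBot (nhds 0))
    (hNLD : NLDSystem c θ μ β₁ β₂ Ψm (fun y => (starRingEnd ℂ) (Ψm y)))
    (φ₁ φ₂ : ℝ → ℂ)
    (hφ₁ : Differentiable ℝ φ₁) (hφ₂ : Differentiable ℝ φ₂)
    (hφ : LinDiracSystem c θ μ β₁ β₂ Ψm φ₁ φ₂)
    (hconj : ∀ x : ℝ, (starRingEnd ℂ) (φ₁ x) = φ₂ x)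
    (hφ₁top : Tendsto φ₁ atTop (nhds 0)) (hφ₁bot : Tendsto φ₁ atBot (nhds 0))
    (hφ₂top : Tendsto φ₂ atTop (nhds 0)) (hφ₂bot : Tendsto φ₂ atBot (nhds 0)) :
    ∃ l : ℝ, (∀ x : ℝ, φ₁ x = (l : ℂ) * deriv Ψm x) ∧
      (∀ x : ℝ, φ₂ x = (l : ℂ) * deriv (fun y => (starRingEnd ℂ) (Ψm y)) x) := by
  have hΨd : ∀ y, HasDerivAt Ψm (deriv Ψm y) y := fun y =>
    ((hΨsmooth.differentiable (by simp)) y).hasDerivAt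
  have hcC : (c : ℂ) ≠ 0 := by exact_mod_cast hc
  -- the profile equation, solved for the derivative
  have hE : deriv Ψm = fun y => -(Complex.I / c) * ((μ : ℂ) * Ψm y - θ * (starRingEnd ℂ) (Ψm y)
      + 3 * β₁ * (Ψm y ^ 2 * (starRingEnd ℂ) (Ψm y)) + β₂ * (starRingEnd ℂ) (Ψm y) ^ 3) := by
    funext y
    have h := (hNLD y).1
    simp only [Complex.normSq_conj, Complex.normSq_eq_conj_mul_self] at h
    have h2 : deriv Ψm y = -(Complex.I / c) * (Complex.I * c * deriv Ψm y) := by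
      field_simp; simp
    rw [h2]; congr 1
    linear_combination h
  have hΨ2 : ∀ y, HasDerivAt (deriv Ψm) (linV c θ μ β₁ β₂ (Ψm y) (deriv Ψm y)) y := by
    intro y
    have h1 := hΨd y
    have h2 := hasDerivAt_conj h1
    have h := ((((h1.const_mul (μ : ℂ)).sub (h2.const_mul (θ : ℂ))).add
      (((h1.pow 2).mul h2).const_mul (3 * β₁ : ℂ))).add
      ((h2.pow 3).const_mul (β₂ : ℂ))).const_mul (-(Complex.I / c))
    refine HasDerivAt.congr_deriv (h.congr_of_eventuallyEq
      (Filter.Eventually.of_forall fun x => ?_)) ?_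
    · simpa using congrFun hE x
    clear hE
    simp only [linV]
    push_cast
    rw [Complex.normSq_eq_conj_mul_self]
    simp only [Pi.pow_apply]
    push_cast
    ring
  have hφd : ∀ y, HasDerivAt φ₁ (linV c θ μ β₁ β₂ (Ψm y) (φ₁ y)) y := by
    intro y
    have h := (hφ y).1
    rw [← hconj y] at h
    have h2 : deriv φ₁ y = -(Complex.I / c) * (Complex.I * c * deriv φ₁ y) := by
      field_simp; simp
    have h3 : deriv φ₁ y = linV c θ μ β₁ β₂ (Ψm y) (φ₁ y) := by
      rw [h2, linV]; congr 1
      push_cast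
      linear_combination h
    rw [← h3]
    exact (hφ₁ y).hasDerivAt
  -- the Wronskian vanishes
  have hW : ∀ y, ((starRingEnd ℂ) (deriv Ψm y) * φ₁ y).im = 0 := by
    set W : ℝ → ℝ := fun y => ((starRingEnd ℂ) (deriv Ψm y) * φ₁ y).im with hWdef
    have hWd : ∀ y, HasDerivAt W 0 y := by
      intro y
      have h := (hasDerivAt_conj (hΨ2 y)).mul (hφd y)
      have h' := Complex.imCLM.hasFDerivAt.comp_hasDerivAt y h
      have h0 := wronskian_zero c θ μ β₁ β₂ (Ψm y) (deriv Ψm y) (φ₁ y)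
      rw [← h0]
      exact h'
    have hconst : ∀ x y, W x = W y :=
      is_const_of_deriv_eq_zero (fun y => (hWd y).differentiableAt) (fun y => (hWd y).deriv)
    have hlim : Tendsto W atTop (nhds 0) := by
      have h1 := ((Complex.continuous_conj.tendsto 0).comp hΨ'top).mul hφ₁top
      have h2 := (Complex.continuous_im.tendsto _).comp h1
      simp only [map_zero, mul_zero, Complex.zero_im] at h2
      exact h2
    intro y
    have h3 : Tendsto W atTop (nhds (W y)) := by
      have : W = fun _ => W y := funext fun x => hconst x y
      rw [this]; exact tendsto_const_nhds
    exact tendsto_nhds_unique h3 hlim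
  -- a point where the derivative of the profile is nonzero
  obtain ⟨y0, hy0⟩ : ∃ y0, deriv Ψm y0 ≠ 0 := by
    by_contra! hall
    apply hΨne
    intro y
    have hconst := is_const_of_deriv_eq_zero (fun y => (hΨd y).differentiableAt) hall
    have h3 : Tendsto Ψm atTop (nhds (Ψm y)) := by
      have : Ψm = fun _ => Ψm y := funext fun x => hconst x y
      rw [this]; exact tendsto_const_nhds
    exact tendsto_nhds_unique h3 hΨtop
  obtain ⟨l, hl⟩ : ∃ l : ℝ, φ₁ y0 = l * deriv Ψm y0 := by
    refine ⟨((starRingEnd ℂ) (deriv Ψm y0) * φ₁ y0).re / Complex.normSq (deriv Ψm y0), ?_⟩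
    have h1 : ((((starRingEnd ℂ) (deriv Ψm y0) * φ₁ y0).re : ℝ) : ℂ) =
        (starRingEnd ℂ) (deriv Ψm y0) * φ₁ y0 := by
      apply Complex.ext
      · simp
      · rw [hW y0]; simp
    have h2 : (starRingEnd ℂ) (deriv Ψm y0) ≠ 0 := by simpa using hy0
    rw [Complex.ofReal_div, h1, Complex.normSq_eq_conj_mul_self]
    field_simp
  -- boundedness of the profile
  obtain ⟨M, hM⟩ : ∃ M : ℝ, ∀ y, ‖Ψm y‖ ≤ M := by
    have hz : Tendsto Ψm (cocompact ℝ) (nhds 0) := by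
      rw [cocompact_eq_atBot_atTop]
      exact hΨbot.sup hΨtop
    let F : ZeroAtInftyContinuousMap ℝ ℂ := ⟨⟨Ψm, hΨsmooth.continuous⟩, hz⟩
    exact ⟨‖F.toBCF‖, fun y => F.toBCF.norm_coe_le_norm y⟩
  have huniq : φ₁ = fun x => (l : ℂ) * deriv Ψm x := by
    refine ODE_solution_unique_univ (v := fun t => linV c θ μ β₁ β₂ (Ψm t))
      (s := fun _ => Set.univ)
      (K := Real.toNNReal (|c|⁻¹ * ((|μ| + 6 * |β₁| * M ^ 2) +
        (3 * (|β₁| * M ^ 2 + |β₂| * M ^ 2) + |θ|)))) (t₀ := y0) ?_ ?_ ?_ hl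
    · intro t
      apply LipschitzWith.lipschitzOnWith
      apply LipschitzWith.of_dist_le_mul
      intro a b
      rw [dist_eq_norm, dist_eq_norm, linV_sub, Real.coe_toNNReal _ (by positivity)]
      exact linV_bound c θ μ β₁ β₂ (Ψm t) (a - b) M (hM t)
    · exact fun t => ⟨hφd t, Set.mem_univ _⟩
    · intro t
      refine ⟨?_, Set.mem_univ _⟩
      have h := (hΨ2 t).const_mul (l : ℂ)
      rw [← linV_smul] at h
      exact h
  refine ⟨l, fun x => congrFun huniq x, fun x => ?_⟩
  rw [(hasDerivAt_conj (hΨd x)).deriv, ← hconj x, huniq]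
  simp
end

section
/- Let c, θ, μ, β₁, β₂ ∈ ℝ with c ≠ 0. Let Ψ₋ : ℝ → ℂ be infinitely differentiable, not identically zero, with Ψ₋(y) → 0 and Ψ₋'(y) → 0 as y → +∞ and as y → −∞, and satisfying the reflection symmetry Ψ₋(−y) = conj(Ψ₋(y)) for all y ∈ ℝ; set Ψ₊(y) := conj(Ψ₋(y)) and suppose (Ψ₋, Ψ₊) solves the NLD system. If (φ₁, φ₂) is a pair of differentiable functions ℝ → ℂ solving the linearized Dirac system (L) associated with Ψ₋, satisfying conj(φ₁(x)) = φ₂(x) and φ₁(−x) = φ₂(x) for all x ∈ ℝ, and with φ₁(x), φ₂(x) → 0 as x → +∞ and as x → −∞, then φ₁ and φ₂ are identically zero. -/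
open Complex Filter

/-- Uniqueness of the zero solution of the real-linear ODE below. -/
lemma lin_unique (c : ℝ) (a b : ℝ → ℂ) (ha : Continuous a) (hb : Continuous b)
    (u : ℝ → ℂ)
    (hu : ∀ t, HasDerivAt u (-(I / c) * (a t * u t + b t * (starRingEnd ℂ) (u t))) t)
    (h0 : u 0 = 0) : ∀ t, u t = 0 := by
  intro t
  set T : ℝ := |t| + 1 with hT
  obtain ⟨A, hA⟩ := (isCompact_Icc (a := -T) (b := T)).exists_bound_of_continuousOn
    ha.continuousOn
  obtain ⟨B, hB⟩ := (isCompact_Icc (a := -T) (b := T)).exists_bound_of_continuousOn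
    hb.continuousOn
  set K : ℝ := ‖(I / c : ℂ)‖ * (A + B) with hK
  have hbd : ∀ s ∈ Set.Icc (-T) T, ∀ z : ℂ,
      ‖-(I / c) * (a s * z + b s * (starRingEnd ℂ) z)‖ ≤ K * ‖z‖ := by
    intro s hs z
    have h1 : ‖a s * z + b s * (starRingEnd ℂ) z‖ ≤ (A + B) * ‖z‖ := by
      refine (norm_add_le _ _).trans ?_
      rw [norm_mul, norm_mul, RCLike.norm_conj]
      have := mul_le_mul_of_nonneg_right (hA s hs) (norm_nonneg z)
      have := mul_le_mul_of_nonneg_right (hB s hs) (norm_nonneg z)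
      linarith
    rw [norm_mul, norm_neg, hK, mul_assoc]
    exact mul_le_mul_of_nonneg_left h1 (norm_nonneg _)
  have hlip : ∀ s ∈ Set.Ioo (-T) T, LipschitzOnWith K.toNNReal
      (fun z : ℂ => -(I / c) * (a s * z + b s * (starRingEnd ℂ) z)) Set.univ := by
    intro s hs
    rw [lipschitzOnWith_univ]
    refine LipschitzWith.of_dist_le_mul fun x y => ?_
    rw [dist_eq_norm, dist_eq_norm]
    have h2 := hbd s (Set.Ioo_subset_Icc_self hs) (x - y)
    have h3 : -(I / c) * (a s * x + b s * (starRingEnd ℂ) x)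
        - -(I / c) * (a s * y + b s * (starRingEnd ℂ) y)
        = -(I / c) * (a s * (x - y) + b s * (starRingEnd ℂ) (x - y)) := by
      rw [map_sub]; ring
    simp only [h3]
    refine h2.trans ?_
    exact mul_le_mul_of_nonneg_right (Real.le_coe_toNNReal K) (norm_nonneg _)
  have hTpos : |t| < T := by rw [hT]; linarith
  have h := ODE_solution_unique_of_mem_Icc (t₀ := 0) (a := -T) (b := T)
    (v := fun s z => -(I / c) * (a s * z + b s * (starRingEnd ℂ) z))
    (s := fun _ => Set.univ) (K := K.toNNReal) (f := u) (g := fun _ => 0)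
    hlip ⟨by linarith [abs_nonneg t], by linarith [abs_nonneg t]⟩
    (fun x _ => (hu x).continuousAt.continuousWithinAt)
    (fun s _ => hu s) (fun _ _ => Set.mem_univ _)
    continuousOn_const
    (fun s _ => by simpa using hasDerivAt_const s (0 : ℂ))
    (fun _ _ => Set.mem_univ _) h0
  exact h ⟨(abs_lt.mp hTpos).1.le, (abs_lt.mp hTpos).2.le⟩

/-- Constancy of the Wronskian. -/
lemma wronskian_const (c : ℝ) (a : ℝ → ℝ) (b : ℝ → ℂ) (u w : ℝ → ℂ)
    (hu : ∀ t, HasDerivAt u (-(I / c) * ((a t : ℂ) * u t + b t * (starRingEnd ℂ) (u t))) t)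
    (hw : ∀ t, HasDerivAt w (-(I / c) * ((a t : ℂ) * w t + b t * (starRingEnd ℂ) (w t))) t) :
    ∀ s t, (u s * (starRingEnd ℂ) (w s)).im = (u t * (starRingEnd ℂ) (w t)).im := by
  have hd : ∀ t, HasDerivAt (fun t => (u t * (starRingEnd ℂ) (w t)).im) 0 t := by
    intro t
    have h := (hu t).mul (hw t).star
    have h2 := (Complex.imCLM.hasFDerivAt.comp_hasDerivAt t h)
    refine HasDerivAt.congr_deriv h2 ?_
    simp only [Complex.imCLM_apply, Complex.star_def, map_mul, map_add, map_neg, map_div₀,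
      Complex.conj_I, Complex.conj_ofReal, Complex.conj_conj]
    have : ∀ z : ℂ, z / (c : ℂ) = z * ((c⁻¹ : ℝ) : ℂ) := by
      intro z; rw [Complex.ofReal_inv, div_eq_mul_inv]
    simp only [this]
    generalize c⁻¹ = d
    simp
    ring
  intro s t
  exact is_const_of_deriv_eq_zero (fun x => (hd x).differentiableAt) (fun x => (hd x).deriv) s t

theorem stmt_15 (c θ μ β₁ β₂ : ℝ) (hc : c ≠ 0) (Ψm : ℝ → ℂ)
    (hΨsmooth : ContDiff ℝ (⊤ : ℕ∞) Ψm)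
    (hΨne : ¬ ∀ y : ℝ, Ψm y = 0)
    (hΨtop : Tendsto Ψm atTop (nhds 0)) (hΨbot : Tendsto Ψm atBot (nhds 0))
    (hΨ'top : Tendsto (deriv Ψm) atTop (nhds 0))
    (hΨ'bot : Tendsto (deriv Ψm) atBot (nhds 0))
    (hΨrefl : ∀ y : ℝ, Ψm (-y) = (starRingEnd ℂ) (Ψm y))
    (hNLD : NLDSystem c θ μ β₁ β₂ Ψm (fun y => (starRingEnd ℂ) (Ψm y)))
    (φ₁ φ₂ : ℝ → ℂ)
    (hφ₁ : Differentiable ℝ φ₁) (hφ₂ : Differentiable ℝ φ₂)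
    (hφ : LinDiracSystem c θ μ β₁ β₂ Ψm φ₁ φ₂)
    (hconj : ∀ x : ℝ, (starRingEnd ℂ) (φ₁ x) = φ₂ x)
    (hrefl : ∀ x : ℝ, φ₁ (-x) = φ₂ x)
    (hφ₁top : Tendsto φ₁ atTop (nhds 0)) (hφ₁bot : Tendsto φ₁ atBot (nhds 0))
    (hφ₂top : Tendsto φ₂ atTop (nhds 0)) (hφ₂bot : Tendsto φ₂ atBot (nhds 0)) :
    (∀ x : ℝ, φ₁ x = 0) ∧ (∀ x : ℝ, φ₂ x = 0) := by
  have hcC : (c : ℂ) ≠ 0 := by exact_mod_cast hc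
  have hΨd : Differentiable ℝ Ψm := hΨsmooth.differentiable (by simp)
  have hΨc : Continuous Ψm := hΨd.continuous
  set a : ℝ → ℝ := fun t => μ + 6 * β₁ * Complex.normSq (Ψm t) with ha
  set b : ℝ → ℂ := fun t =>
    3 * ((β₁ : ℂ) * (Ψm t) ^ 2 + (β₂ : ℂ) * ((starRingEnd ℂ) (Ψm t)) ^ 2) - θ with hb
  have hac : Continuous (fun t => (a t : ℂ)) := by
    have : Continuous a := by
      have := Complex.continuous_normSq.comp hΨc
      simp only [ha]
      exact continuous_const.add (continuous_const.mul this)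
    exact Complex.continuous_ofReal.comp this
  have hbc : Continuous b := by
    have : Continuous fun t => (starRingEnd ℂ) (Ψm t) := Complex.continuous_conj.comp hΨc
    simp only [hb]
    fun_prop
  have solve : ∀ X Y : ℂ, I * c * X = Y → X = -(I / c) * Y := by
    intro X Y h
    rw [← h]
    field_simp
    rw [Complex.I_sq]; ring
  -- equation for φ₁
  have hφeq : ∀ t, HasDerivAt φ₁
      (-(I / c) * ((a t : ℂ) * φ₁ t + b t * (starRingEnd ℂ) (φ₁ t))) t := by
    intro t
    have h := (hφ₁ t).hasDerivAt
    rw [← solve (deriv φ₁ t) ((a t : ℂ) * φ₁ t + b t * (starRingEnd ℂ) (φ₁ t))]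
    · exact h
    · have h1 := (hφ t).1
      rw [hconj]
      simp only [ha, hb]
      push_cast
      linear_combination h1
  -- equation for the derivative of the profile
  have hΨ1 : deriv Ψm = fun t => -(I / c) * ((μ : ℂ) * Ψm t - θ * (starRingEnd ℂ) (Ψm t)
      + 3 * β₁ * ((Ψm t) ^ 2 * (starRingEnd ℂ) (Ψm t)) + β₂ * (starRingEnd ℂ) (Ψm t) ^ 3) := by
    funext t
    apply solve
    have h1 := (hNLD t).1
    simp only [Complex.normSq_conj, ← Complex.mul_conj] at h1
    linear_combination h1
  have hΨeq : ∀ t, HasDerivAt (deriv Ψm)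
      (-(I / c) * ((a t : ℂ) * deriv Ψm t + b t * (starRingEnd ℂ) (deriv Ψm t))) t := by
    intro t
    have h := (hΨd t).hasDerivAt
    have hs : HasDerivAt (fun t => (starRingEnd ℂ) (Ψm t)) ((starRingEnd ℂ) (deriv Ψm t)) t :=
      h.star
    generalize hD : deriv Ψm t = D at h hs ⊢
    rw [hΨ1]
    have h2 := ((((h.const_mul (μ : ℂ)).sub (hs.const_mul (θ : ℂ))).add
      (((h.pow 2).mul hs).const_mul (3 * β₁ : ℂ))).add
      ((hs.pow 3).const_mul (β₂ : ℂ))).const_mul (-(I / c : ℂ))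
    refine HasDerivAt.congr_deriv h2 ?_
    simp only [ha, hb]
    push_cast
    simp only [← Complex.mul_conj, Pi.pow_apply]
    push_cast
    ring
  -- Wronskian
  have hW := wronskian_const c a b φ₁ (deriv Ψm) hφeq hΨeq
  have hlim : Tendsto (fun t => (φ₁ t * (starRingEnd ℂ) (deriv Ψm t)).im) atTop (nhds 0) := by
    have h1 := (Complex.continuous_conj.tendsto 0).comp hΨ'top
    have h2 := (Complex.continuous_im.tendsto _).comp (hφ₁top.mul h1)
    simpa [Function.comp_def] using h2
  have hW0 : (φ₁ 0 * (starRingEnd ℂ) (deriv Ψm 0)).im = 0 := by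
    refine tendsto_nhds_unique ?_ hlim
    have : (fun t => (φ₁ t * (starRingEnd ℂ) (deriv Ψm t)).im)
        = fun _ => (φ₁ 0 * (starRingEnd ℂ) (deriv Ψm 0)).im := by
      funext t; exact hW t 0
    rw [this]
    exact tendsto_const_nhds
  have him : (φ₁ 0).im = 0 := by
    have h1 := hrefl 0
    rw [neg_zero, ← hconj] at h1
    exact Complex.conj_eq_iff_im.mp h1.symm
  have hre : (deriv Ψm 0).re = 0 := by
    have h := (hΨd 0).hasDerivAt
    have hs : HasDerivAt (fun t => (starRingEnd ℂ) (Ψm t)) ((starRingEnd ℂ) (deriv Ψm 0)) 0 :=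
      h.star
    have h3 : deriv (fun t => Ψm (-t)) 0 = - deriv Ψm 0 := by
      rw [deriv_comp_neg, neg_zero]
    have h4 : (fun t => Ψm (-t)) = fun t => (starRingEnd ℂ) (Ψm t) := funext hΨrefl
    rw [h4, hs.deriv] at h3
    have := congrArg Complex.re h3
    simp at this
    linarith
  have hprod : (φ₁ 0).re * (deriv Ψm 0).im = 0 := by
    simp [him] at hW0
    simpa using hW0
  have hD0 : (deriv Ψm 0).im ≠ 0 := by
    intro h0
    have hz := lin_unique c (fun t => (a t : ℂ)) b hac hbc (deriv Ψm) hΨeq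
      (Complex.ext hre h0)
    apply hΨne
    intro y
    refine tendsto_nhds_unique ?_ hΨtop
    have : Ψm = fun _ => Ψm y := by
      funext t; exact is_const_of_deriv_eq_zero hΨd hz t y
    rw [this]
    exact tendsto_const_nhds
  have hφ0 : φ₁ 0 = 0 :=
    Complex.ext ((mul_eq_zero.mp hprod).resolve_right hD0) him
  have hfin := lin_unique c (fun t => (a t : ℂ)) b hac hbc φ₁ hφeq hφ0
  exact ⟨hfin, fun x => by rw [← hconj, hfin, map_zero]⟩
end

section
/- Let f, g : ℝ → ℂ be continuous functions such that g(−x) = f(x), f(x + 1) = −f(x) and g(x + 1) = −g(x) for all x ∈ ℝ. Then the integral ∫₀¹ conj(g(x))² · f(x)² dx is a real number, i.e., it equals its own complex conjugate. -/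
theorem stmt_16 (f g : ℝ → ℂ) (hf : Continuous f) (hg : Continuous g)
    (hrefl : ∀ x : ℝ, g (-x) = f x)
    (hfper : ∀ x : ℝ, f (x + 1) = -f x)
    (hgper : ∀ x : ℝ, g (x + 1) = -g x) :
    (starRingEnd ℂ) (∫ x in (0:ℝ)..1, ((starRingEnd ℂ) (g x)) ^ 2 * (f x) ^ 2) =
      ∫ x in (0:ℝ)..1, ((starRingEnd ℂ) (g x)) ^ 2 * (f x) ^ 2 := by
  have h1 : ∀ x : ℝ, g (1 - x) = -f x := by
    intro x
    rw [← hrefl x, ← hgper]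
    congr 1
    ring
  have h2 : ∀ x : ℝ, f (1 - x) = -g x := by
    intro x
    have h := hrefl (-x)
    rw [neg_neg] at h
    rw [h, ← hfper]
    congr 1
    ring
  have key := intervalIntegral.integral_comp_sub_left (a := 0) (b := 1)
    (fun x : ℝ => ((starRingEnd ℂ) (g x)) ^ 2 * (f x) ^ 2) 1
  simp only [sub_self, sub_zero] at key
  refine Eq.trans ?_ key
  rw [intervalIntegral.integral_of_le zero_le_one,
    intervalIntegral.integral_of_le zero_le_one, ← integral_conj]
  congr 1
  funext x
  simp only [h1, h2, map_mul, map_pow, map_neg, Complex.conj_conj]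
  ring
end
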